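/- arXiv:1008.3577 — 2 statements merged into one kernel-verified Lean document; each statement's English description precedes it below -/
import Mathlib

section
/- Let P = {y ∈ ℝⁿ : l_k(y) ≥ 0, k = 1,…,d} be a compact convex polytope with nonempty interior as in the Guillemin-form setup, and let u = u_G + F be of Guillemin form with F of class C¹ on an open neighborhood of P. Then the subdifferential of u is empty at every boundary point: for every y ∈ ∂P there is no vector v ∈ ℝⁿ satisfying u(z) ≥ u(y) + ⟨v, z − y⟩ for all z ∈ P. -/
open scoped RealInnerProductSpace
open Set Filter

noncomputable section

/-- The affine-linear defining function `l_k(y) = ⟨y, v_k⟩ - λ_k` of the `k`-th facet. -/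
def ell {n d : ℕ} (v : Fin d → EuclideanSpace ℝ (Fin n)) (lam : Fin d → ℝ)
    (k : Fin d) (y : EuclideanSpace ℝ (Fin n)) : ℝ := ⟪y, v k⟫ - lam k

/-- The polytope `P = {y : l_k(y) ≥ 0, k = 1,…,d}`. -/
def poly {n d : ℕ} (v : Fin d → EuclideanSpace ℝ (Fin n)) (lam : Fin d → ℝ) :
    Set (EuclideanSpace ℝ (Fin n)) := {y | ∀ k, 0 ≤ ell v lam k y}

/-- The Guillemin potential `u_G(y) = Σ_k l_k(y) log l_k(y)` (with `0·log 0 = 0`,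
which holds by the convention `Real.log 0 = 0`). -/
def uG {n d : ℕ} (v : Fin d → EuclideanSpace ℝ (Fin n)) (lam : Fin d → ℝ)
    (y : EuclideanSpace ℝ (Fin n)) : ℝ :=
  ∑ k, ell v lam k y * Real.log (ell v lam k y)

/-- `P ∩ {l_k = 0}` is a facet of `P`: it is nonempty and its affine span has
dimension `n - 1`. -/
def IsFacet {n d : ℕ} (v : Fin d → EuclideanSpace ℝ (Fin n)) (lam : Fin d → ℝ)
    (k : Fin d) : Prop :=
  (poly v lam ∩ {y | ell v lam k y = 0}).Nonempty ∧
  Module.finrank ℝ (affineSpan ℝ (poly v lam ∩ {y | ell v lam k y = 0})).direction = n - 1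

lemma ell_lineMap {n d : ℕ} (v : Fin d → EuclideanSpace ℝ (Fin n)) (lam : Fin d → ℝ)
    (k : Fin d) (x y : EuclideanSpace ℝ (Fin n)) (t : ℝ) :
    ell v lam k (y + t • (x - y)) = (1 - t) * ell v lam k y + t * ell v lam k x := by
  simp only [ell, inner_add_left, inner_sub_left, real_inner_smul_left]
  ring

lemma continuous_ell {n d : ℕ} (v : Fin d → EuclideanSpace ℝ (Fin n)) (lam : Fin d → ℝ)
    (k : Fin d) : Continuous (ell v lam k) := by
  unfold ell
  fun_prop

lemma isClosed_poly {n d : ℕ} (v : Fin d → EuclideanSpace ℝ (Fin n)) (lam : Fin d → ℝ) :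
    IsClosed (poly v lam) := by
  simp only [poly, ofPred_forall]
  exact isClosed_iInter fun k => isClosed_le continuous_const (continuous_ell v lam k)

lemma ell_pos_of_mem_interior {n d : ℕ} {v : Fin d → EuclideanSpace ℝ (Fin n)}
    {lam : Fin d → ℝ} {k : Fin d} (hvk : v k ≠ 0) {x : EuclideanSpace ℝ (Fin n)}
    (hx : x ∈ interior (poly v lam)) : 0 < ell v lam k x := by
  have hlim : Tendsto (fun t : ℝ => x - t • v k) (nhdsWithin 0 (Ioi 0)) (nhds x) := by
    have : Continuous fun t : ℝ => x - t • v k := by fun_prop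
    simpa using (this.tendsto 0).mono_left nhdsWithin_le_nhds
  obtain ⟨t, ht, ht0⟩ :=
    ((hlim.eventually (mem_interior_iff_mem_nhds.1 hx)).and self_mem_nhdsWithin).exists
  have hk : 0 ≤ ell v lam k (x - t • v k) := ht k
  have hpos : 0 < t * ⟪v k, v k⟫ := mul_pos ht0 (real_inner_self_pos.2 hvk)
  simp only [ell, inner_sub_left, real_inner_smul_left] at hk ⊢
  linarith

lemma exists_ell_eq_zero_of_mem_frontier {n d : ℕ} {v : Fin d → EuclideanSpace ℝ (Fin n)}
    {lam : Fin d → ℝ} {y : EuclideanSpace ℝ (Fin n)} (hy : y ∈ frontier (poly v lam)) :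
    ∃ k, ell v lam k y = 0 := by
  by_contra! hne
  have hyP : y ∈ poly v lam := (isClosed_poly v lam).frontier_subset hy
  refine hy.2 (mem_interior_iff_mem_nhds.2 ?_)
  have hev : ∀ᶠ z in nhds y, ∀ k, 0 < ell v lam k z := eventually_all.2 fun k =>
    (continuous_ell v lam k).continuousAt.eventually_const_lt ((hyP k).lt_of_ne' (hne k))
  filter_upwards [hev] with z hz k using (hz k).le

/-- Along the segment from a point `y` of `P` with `l_k(y) = 0` to a point `x` of `P` with
`l_k(x) > 0`, the potential `u_G` lies below its chord by at least `-t l_k(x) log t`. -/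
lemma uG_segment_le {n d : ℕ} {v : Fin d → EuclideanSpace ℝ (Fin n)} {lam : Fin d → ℝ}
    {x y : EuclideanSpace ℝ (Fin n)} (hx : x ∈ poly v lam) (hy : y ∈ poly v lam)
    {k : Fin d} (hyk : ell v lam k y = 0) (hxk : 0 < ell v lam k x)
    {t : ℝ} (ht0 : 0 < t) (ht1 : t ≤ 1) :
    uG v lam (y + t • (x - y)) ≤
      uG v lam y + t * (uG v lam x - uG v lam y) + t * (ell v lam k x * Real.log t) := by
  have hsum : uG v lam y + t * (uG v lam x - uG v lam y) + t * (ell v lam k x * Real.log t) =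
      ∑ j, ((1 - t) * (ell v lam j y * Real.log (ell v lam j y)) +
        t * (ell v lam j x * Real.log (ell v lam j x)) +
        if j = k then t * (ell v lam k x * Real.log t) else 0) := by
    simp only [uG, Finset.sum_add_distrib, ← Finset.mul_sum, Finset.sum_ite_eq',
      Finset.mem_univ, if_true]
    ring
  rw [hsum, uG]
  refine Finset.sum_le_sum fun j _ => ?_
  rw [ell_lineMap]
  split_ifs with hj
  · subst hj
    rw [hyk, mul_zero, zero_add, Real.log_mul ht0.ne' hxk.ne']
    apply le_of_eq
    ring
  · simpa using Real.convexOn_mul_log.2 (hy j) (hx j) (sub_nonneg.2 ht1) ht0.le (by ring)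

/-- For a potential `u = u_G + F` of Guillemin form on a compact convex
polytope `P` with nonempty interior, the subdifferential of `u` is empty at every boundary
point of `P`: no vector `w` satisfies `u(z) ≥ u(y) + ⟨w, z - y⟩` for all `z ∈ P`. -/
theorem subdifferential_empty_on_boundary
    (n d : ℕ) (v : Fin d → EuclideanSpace ℝ (Fin n)) (lam : Fin d → ℝ)
    (hv : ∀ k, v k ≠ 0)
    (hPc : IsCompact (poly v lam)) (hPint : (interior (poly v lam)).Nonempty)
    (hfacet : ∀ k, IsFacet v lam k)
    (F : EuclideanSpace ℝ (Fin n) → ℝ) (V : Set (EuclideanSpace ℝ (Fin n)))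
    (hV : IsOpen V) (hPV : poly v lam ⊆ V) (hF : ContDiffOn ℝ 1 F V)
    (u : EuclideanSpace ℝ (Fin n) → ℝ) (hu : ∀ y, u y = uG v lam y + F y) :
    ∀ y ∈ frontier (poly v lam),
      ¬ ∃ w : EuclideanSpace ℝ (Fin n), ∀ z ∈ poly v lam, u y + ⟪w, z - y⟫ ≤ u z := by
  rintro y hy ⟨w, hw⟩
  obtain ⟨x, hx⟩ := hPint
  obtain ⟨k, hyk⟩ := exists_ell_eq_zero_of_mem_frontier hy
  have hyP : y ∈ poly v lam := (isClosed_poly v lam).frontier_subset hy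
  have hxP : x ∈ poly v lam := interior_subset hx
  have hxk : 0 < ell v lam k x := ell_pos_of_mem_interior (hv k) hx
  have hFy : HasFDerivAt F (fderiv ℝ F y) y :=
    ((hF.contDiffAt (hV.mem_nhds (hPV hyP))).differentiableAt one_ne_zero).hasFDerivAt
  have hslope : Tendsto (fun t : ℝ => t⁻¹ • (F (y + t • (x - y)) - F y))
      (nhdsWithin 0 (Ioi 0)) (nhds (fderiv ℝ F y (x - y))) :=
    (hFy.hasLineDerivAt (x - y)).tendsto_slope_zero_right
  have hlog : Tendsto (fun t : ℝ => ell v lam k x * Real.log t) (nhdsWithin 0 (Ioi 0)) atBot :=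
    Real.tendsto_log_nhdsGT_zero.const_mul_atBot hxk
  have hbot := hlog.atBot_add hslope
  obtain ⟨t, ht, ht0, ht1⟩ := ((hbot.eventually_lt_atBot
    (⟪w, x - y⟫ - (uG v lam x - uG v lam y))).and
      (Ioc_mem_nhdsGT (zero_lt_one' ℝ))).exists
  have hz : y + t • (x - y) ∈ poly v lam := fun j => by
    rw [ell_lineMap]
    exact add_nonneg (mul_nonneg (sub_nonneg.2 ht1) (hyP j)) (mul_nonneg ht0.le (hxP j))
  have hsub := hw _ hz
  rw [hu, hu, add_sub_cancel_left, real_inner_smul_right] at hsub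
  have hseg := uG_segment_le hxP hyP hyk hxk ht0 ht1
  have hmul := mul_lt_mul_of_pos_left ht ht0
  rw [smul_eq_mul, mul_add, mul_inv_cancel_left₀ ht0.ne'] at hmul
  linarith
end
end

section
/- Assume the Delzant toric setup: P is a Delzant lattice polytope, u₀ = u_G + F₀ is a strictly convex Guillemin-form symplectic potential, ψ₀ is its Legendre transform (smooth, strictly convex, with ∇ψ₀ a diffeomorphism from ℝⁿ onto the interior of P), u̇₀ is smooth on a neighborhood of P, and Q_N(α) := ∫_{ℝⁿ} e^{⟨α,x⟩ − N·ψ₀(x)}·det(∇²ψ₀(x)) dx. For s ≥ 0 define ψ_s(x) := sup_{y∈P}( ⟨x,y⟩ − u₀(y) − s·u̇₀(y) ) and E_N(s,x) := (1/N)·log( Σ_{α ∈ ℤⁿ, α/N ∈ P} e^{−s·N·u̇₀(α/N)}·e^{⟨α,x⟩ − N·ψ_s(x)} / Q_N(α) ). Then for every T > 0: lim_{N→∞} sup_{s∈[0,T]} sup_{x∈ℝⁿ} |E_N(s,x)| = 0. -/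
open scoped RealInnerProductSpace
open Set Filter MeasureTheory

noncomputable section

/-- The point `α/N ∈ ℝⁿ` associated to a lattice point `α ∈ ℤⁿ`. -/
def latPt {n : ℕ} (α : Fin n → ℤ) (N : ℕ) : EuclideanSpace ℝ (Fin n) :=
  (WithLp.equiv 2 (Fin n → ℝ)).symm fun i => (α i : ℝ) / N

/-- A lattice vector `α ∈ ℤⁿ` viewed as a point of `ℝⁿ`. -/
def intPt {n : ℕ} (α : Fin n → ℤ) : EuclideanSpace ℝ (Fin n) :=
  (WithLp.equiv 2 (Fin n → ℝ)).symm fun i => (α i : ℝ)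

/-- The affine-linear defining function `l_k(y) = ⟨y, v_k⟩ - λ_k` (integral data). -/
def ellZ {n d : ℕ} (v : Fin d → Fin n → ℤ) (lam : Fin d → ℤ) (k : Fin d)
    (y : EuclideanSpace ℝ (Fin n)) : ℝ := ⟪y, intPt (v k)⟫ - (lam k : ℝ)

/-- The lattice polytope `P = {y : l_k(y) ≥ 0, k = 1,…,d}`. -/
def polyZ {n d : ℕ} (v : Fin d → Fin n → ℤ) (lam : Fin d → ℤ) :
    Set (EuclideanSpace ℝ (Fin n)) := {y | ∀ k, 0 ≤ ellZ v lam k y}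

/-- The Guillemin potential `u_G(y) = Σ_k l_k(y) log l_k(y)` (with `0·log 0 = 0`). -/
def uGZ {n d : ℕ} (v : Fin d → Fin n → ℤ) (lam : Fin d → ℤ)
    (y : EuclideanSpace ℝ (Fin n)) : ℝ :=
  ∑ k, ellZ v lam k y * Real.log (ellZ v lam k y)

/-- `P ∩ {l_k = 0}` is a facet of `P`: nonempty with affine span of dimension `n - 1`. -/
def IsFacetZ {n d : ℕ} (v : Fin d → Fin n → ℤ) (lam : Fin d → ℤ) (k : Fin d) : Prop :=
  (polyZ v lam ∩ {y | ellZ v lam k y = 0}).Nonempty ∧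
  Module.finrank ℝ (affineSpan ℝ (polyZ v lam ∩ {y | ellZ v lam k y = 0})).direction = n - 1

/-- The Delzant condition at the vertices: every vertex (extreme point) of `P` has exactly
`n` active normals and these span `ℤⁿ` over `ℤ` (hence form a `ℤ`-basis of `ℤⁿ`). -/
def DelzantVertices {n d : ℕ} (v : Fin d → Fin n → ℤ) (lam : Fin d → ℤ) : Prop :=
  ∀ y ∈ Set.extremePoints ℝ (polyZ v lam),
    {k : Fin d | ellZ v lam k y = 0}.ncard = n ∧
    Submodule.span ℤ (v '' {k : Fin d | ellZ v lam k y = 0}) = (⊤ : Submodule ℤ (Fin n → ℤ))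

/-- The determinant of the Hessian matrix `∇²ψ(x)` of a function `ψ : ℝⁿ → ℝ`. -/
def hessDet {n : ℕ} (ψ : EuclideanSpace ℝ (Fin n) → ℝ) (x : EuclideanSpace ℝ (Fin n)) : ℝ :=
  Matrix.det (Matrix.of fun i j =>
    iteratedFDeriv ℝ 2 ψ x ![EuclideanSpace.single i 1, EuclideanSpace.single j 1])

section LegendreDuality

variable {E : Type*} [NormedAddCommGroup E] [InnerProductSpace ℝ E]

/-- The supremum defining the Legendre transform over a compact set is attained. -/
theorem exists_legendre_maximizer {P : Set E} (hP : IsCompact P) (hne : P.Nonempty)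
    {u : E → ℝ} (hu : ContinuousOn u P) (x : E) :
    ∃ y ∈ P, sSup ((fun y => ⟪x, y⟫ - u y) '' P) = ⟪x, y⟫ - u y ∧
      ∀ z ∈ P, ⟪x, z⟫ - u z ≤ ⟪x, y⟫ - u y :=
  hP.exists_sSup_image_eq_and_ge hne (by fun_prop)

/-- An affine minorant touching a differentiable function at a point has the gradient there
as its slope. -/
theorem gradient_eq_of_affine_minorant [CompleteSpace E] {ψ : E → ℝ} {x y : E} {c : ℝ}
    (hψ : DifferentiableAt ℝ ψ x) (hle : ∀ z, ⟪z, y⟫ - c ≤ ψ z) (heq : ψ x = ⟪x, y⟫ - c) :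
    gradient ψ x = y := by
  have hmin : IsLocalMin (fun z => ψ z - ⟪y, z⟫) x := by
    refine Filter.Eventually.of_forall fun z => ?_
    have := hle z
    simp only [real_inner_comm _ y] at *
    linarith
  have hd : HasFDerivAt (fun z => ψ z - ⟪y, z⟫) (fderiv ℝ ψ x - innerSL ℝ y) x :=
    hψ.hasFDerivAt.sub (innerSL ℝ y).hasFDerivAt
  have h0 := hmin.hasFDerivAt_eq_zero hd
  rw [sub_eq_zero] at h0
  rw [gradient, h0]
  exact (InnerProductSpace.toDual ℝ E).symm_apply_apply y

/-- At every point, the gradient of the Legendre transform realizes the supremum. -/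
theorem legendre_gradient [CompleteSpace E] {P : Set E} (hP : IsCompact P) (hne : P.Nonempty)
    {u ψ : E → ℝ} (hu : ContinuousOn u P)
    (hψ : ∀ x, ψ x = sSup ((fun y => ⟪x, y⟫ - u y) '' P)) (hd : Differentiable ℝ ψ) (x : E) :
    gradient ψ x ∈ P ∧ ψ x = ⟪x, gradient ψ x⟫ - u (gradient ψ x) ∧
      ∀ z ∈ P, ⟪x, z⟫ - u z ≤ ψ x := by
  obtain ⟨y, hyP, hy, hmax⟩ := exists_legendre_maximizer hP hne hu x
  have hgrad : gradient ψ x = y := by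
    refine gradient_eq_of_affine_minorant (c := u y) (hd x) (fun z => ?_) ((hψ x).trans hy)
    obtain ⟨w, -, hw, hwmax⟩ := exists_legendre_maximizer hP hne hu z
    rw [hψ z, hw]
    exact hwmax y hyP
  rw [hgrad, hψ x, hy]
  exact ⟨hyP, rfl, hmax⟩

/-- The differential of a monotone map is positive semidefinite. -/
theorem inner_fderiv_self_nonneg {g : E → E} {x : E} (hg : DifferentiableAt ℝ g x)
    (hmono : ∀ a b, 0 ≤ ⟪g a - g b, a - b⟫) (w : E) : 0 ≤ ⟪fderiv ℝ g x w, w⟫ := by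
  have hline : HasDerivAt (fun t : ℝ => ⟪g (x + t • w), w⟫) ⟪fderiv ℝ g x w, w⟫ 0 := by
    have hl : HasDerivAt (fun t : ℝ => x + t • w) w 0 := by
      simpa using ((hasDerivAt_id (0 : ℝ)).smul_const w).const_add x
    have hg' : HasFDerivAt g (fderiv ℝ g x) (x + (0 : ℝ) • w) := by simpa using hg.hasFDerivAt
    simpa using (hg'.comp_hasDerivAt (0 : ℝ) hl).inner ℝ (hasDerivAt_const (0 : ℝ) w)
  have hm : Monotone fun t : ℝ => ⟪g (x + t • w), w⟫ := by
    intro s t hst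
    rcases hst.eq_or_lt with rfl | hlt
    · rfl
    have h := hmono (x + t • w) (x + s • w)
    rw [add_sub_add_left_eq_sub, ← sub_smul, inner_smul_right, inner_sub_left] at h
    have := nonneg_of_mul_nonneg_right h (sub_pos.2 hlt)
    simpa using this
  rw [← hline.deriv]
  exact hm.deriv_nonneg

end LegendreDuality

section Hessian

variable {n : ℕ} {ψ : EuclideanSpace ℝ (Fin n) → ℝ}

theorem contDiff_gradient (hψ : ContDiff ℝ 2 ψ) : ContDiff ℝ 1 (gradient ψ) :=
  (InnerProductSpace.toDual ℝ (EuclideanSpace ℝ (Fin n))).symm.contDiff.comp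
    (hψ.fderiv_right (m := 1) (by norm_num))

theorem inner_fderiv_gradient (hψ : ContDiff ℝ 2 ψ) (x w z : EuclideanSpace ℝ (Fin n)) :
    ⟪fderiv ℝ (gradient ψ) x w, z⟫ = fderiv ℝ (fderiv ℝ ψ) x w z := by
  have hd : DifferentiableAt ℝ (fderiv ℝ ψ) x :=
    (hψ.fderiv_right (m := 1) (by norm_num)).differentiable (by norm_num) x
  have hg := ((contDiff_gradient hψ).differentiable (by norm_num) x).hasFDerivAt.inner ℝ
    (hasFDerivAt_const z x)
  have hf : HasFDerivAt (fun y => ⟪gradient ψ y, z⟫)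
      ((ContinuousLinearMap.apply ℝ ℝ z).comp (fderiv ℝ (fderiv ℝ ψ) x)) x := by
    have hfun : (fun y => ⟪gradient ψ y, z⟫) = fun y => fderiv ℝ ψ y z :=
      funext fun y => InnerProductSpace.toDual_symm_apply
    rw [hfun]
    exact (ContinuousLinearMap.apply ℝ ℝ z).hasFDerivAt.comp x hd.hasFDerivAt
  simpa using DFunLike.congr_fun (hg.unique hf) w

/-- The Hessian determinant is the Jacobian of the gradient map. -/
theorem hessDet_eq_det_fderiv_gradient (hψ : ContDiff ℝ 2 ψ) (x : EuclideanSpace ℝ (Fin n)) :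
    hessDet ψ x = (fderiv ℝ (gradient ψ) x).det := by
  let b := EuclideanSpace.basisFun (Fin n) ℝ
  rw [ContinuousLinearMap.det, ← LinearMap.det_toMatrix b.toBasis, ← Matrix.det_transpose, hessDet]
  congr 1
  ext i j
  rw [Matrix.transpose_apply, LinearMap.toMatrix_apply, Matrix.of_apply, iteratedFDeriv_two_apply]
  simp only [OrthonormalBasis.coe_toBasis, OrthonormalBasis.coe_toBasis_repr_apply,
    OrthonormalBasis.repr_apply_apply]
  rw [real_inner_comm]
  simp [b, ← inner_fderiv_gradient hψ]

theorem continuous_hessDet (hψ : ContDiff ℝ 2 ψ) : Continuous (hessDet ψ) := by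
  have h : hessDet ψ = fun x => (fderiv ℝ (gradient ψ) x).det :=
    funext (hessDet_eq_det_fderiv_gradient hψ)
  rw [h]
  exact ContinuousLinearMap.continuous_det.comp
    ((contDiff_gradient hψ).continuous_fderiv (by norm_num))

theorem hessDet_nonneg (hψ : ContDiff ℝ 2 ψ)
    (hmono : ∀ a b, 0 ≤ ⟪gradient ψ a - gradient ψ b, a - b⟫) (x : EuclideanSpace ℝ (Fin n)) :
    0 ≤ hessDet ψ x := by
  have hsymm : IsSymmSndFDerivAt ℝ ψ x := hψ.contDiffAt.isSymmSndFDerivAt (by simp)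
  refine Matrix.PosSemidef.det_nonneg (Matrix.PosSemidef.of_dotProduct_mulVec_nonneg ?_ ?_)
  · ext i j
    simp only [Matrix.conjTranspose_apply, Matrix.of_apply, iteratedFDeriv_two_apply, star_trivial]
    exact hsymm _ _
  · intro c
    have h := inner_fderiv_self_nonneg
      ((contDiff_gradient hψ).differentiable (by norm_num) x) hmono
      (∑ i, c i • EuclideanSpace.single i (1 : ℝ))
    rw [inner_fderiv_gradient hψ] at h
    refine h.trans_eq ?_
    symm
    simp only [dotProduct, Matrix.mulVec, Matrix.of_apply, iteratedFDeriv_two_apply, map_sum,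
      map_smul, sum_apply, smul_apply, smul_eq_mul,
      Finset.mul_sum, star_trivial, Pi.star_apply]
    rw [Finset.sum_comm]
    refine Finset.sum_congr rfl fun i _ => Finset.sum_congr rfl fun j _ => ?_
    simp
    ring

/-- Change of variables along the gradient map. -/
theorem integrableOn_hessDet_preimage_gradient (hψ : ContDiff ℝ 2 ψ)
    (hmono : ∀ a b, 0 ≤ ⟪gradient ψ a - gradient ψ b, a - b⟫)
    {U : Set (EuclideanSpace ℝ (Fin n))} (hbij : BijOn (gradient ψ) univ U)
    {A : Set (EuclideanSpace ℝ (Fin n))} (hA : MeasurableSet A) (hAU : A ⊆ U)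
    (hAfin : volume A ≠ ⊤) :
    IntegrableOn (hessDet ψ) (gradient ψ ⁻¹' A) ∧
      ∫ x in gradient ψ ⁻¹' A, hessDet ψ x = volume.real A := by
  have hC := contDiff_gradient hψ
  have hS : MeasurableSet (gradient ψ ⁻¹' A) := hC.continuous.measurable hA
  have himg : gradient ψ '' (gradient ψ ⁻¹' A) = A := by
    refine image_preimage_eq_of_subset fun a ha => ?_
    obtain ⟨x, -, hx⟩ := hbij.surjOn (hAU ha)
    exact ⟨x, hx⟩
  have hinj : InjOn (gradient ψ) (gradient ψ ⁻¹' A) := hbij.injOn.mono (subset_univ _)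
  have hder : ∀ x ∈ gradient ψ ⁻¹' A, HasFDerivWithinAt (gradient ψ) (fderiv ℝ (gradient ψ) x)
      (gradient ψ ⁻¹' A) x := fun x _ =>
    (hC.differentiable (by norm_num) x).hasFDerivAt.hasFDerivWithinAt
  have habs : (fun x => |(fderiv ℝ (gradient ψ) x).det| • (1 : ℝ)) = hessDet ψ := by
    funext x
    rw [← hessDet_eq_det_fderiv_gradient hψ, abs_of_nonneg (hessDet_nonneg hψ hmono x),
      smul_eq_mul, mul_one]
  have hint := integrableOn_image_iff_integrableOn_abs_det_fderiv_smul volume hS hder hinj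
    (fun _ => (1 : ℝ))
  have heq := integral_image_eq_integral_abs_det_fderiv_smul volume hS hder hinj (fun _ => (1 : ℝ))
  rw [himg, habs] at hint
  rw [himg, habs] at heq
  refine ⟨hint.1 (integrableOn_const hAfin), ?_⟩
  rw [← heq]
  simp

end Hessian

section LaplaceBounds

variable {n : ℕ} {P : Set (EuclideanSpace ℝ (Fin n))} {u ψ : EuclideanSpace ℝ (Fin n) → ℝ}

theorem legendre_gradient_monotone (hP : IsCompact P) (hne : P.Nonempty) (hu : ContinuousOn u P)
    (hψ : ∀ x, ψ x = sSup ((fun y => ⟪x, y⟫ - u y) '' P)) (hd : Differentiable ℝ ψ)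
    (a b : EuclideanSpace ℝ (Fin n)) : 0 ≤ ⟪gradient ψ a - gradient ψ b, a - b⟫ := by
  obtain ⟨haP, ha, ha'⟩ := legendre_gradient hP hne hu hψ hd a
  obtain ⟨hbP, hb, hb'⟩ := legendre_gradient hP hne hu hψ hd b
  have h₁ := ha' _ hbP
  have h₂ := hb' _ haP
  simp only [inner_sub_right, real_inner_comm a, real_inner_comm b]
  linarith

theorem integrable_exp_mul_hessDet (hP : IsCompact P) (hne : P.Nonempty) (hu : ContinuousOn u P)
    (hψ : ∀ x, ψ x = sSup ((fun y => ⟪x, y⟫ - u y) '' P)) (hψC : ContDiff ℝ 2 ψ)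
    (hbij : BijOn (gradient ψ) univ (interior P)) {N : ℝ} (hN : 0 ≤ N)
    {β : EuclideanSpace ℝ (Fin n)} (hβ : β ∈ P) :
    Integrable (fun x => Real.exp (N * (⟪β, x⟫ - ψ x)) * hessDet ψ x) ∧
      ∫ x, Real.exp (N * (⟪β, x⟫ - ψ x)) * hessDet ψ x ≤
        Real.exp (N * u β) * volume.real (interior P) := by
  have hd : Differentiable ℝ ψ := hψC.differentiable (by norm_num)
  have hmono := legendre_gradient_monotone hP hne hu hψ hd
  have hpre : gradient ψ ⁻¹' interior P = univ :=
    eq_univ_of_forall fun x => hbij.mapsTo (mem_univ x)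
  obtain ⟨hint, heq⟩ := integrableOn_hessDet_preimage_gradient hψC hmono hbij
    isOpen_interior.measurableSet Subset.rfl
    ((measure_mono interior_subset).trans_lt hP.measure_lt_top).ne
  rw [hpre] at hint heq
  rw [integrableOn_univ] at hint
  rw [setIntegral_univ] at heq
  have hle : ∀ x, Real.exp (N * (⟪β, x⟫ - ψ x)) ≤ Real.exp (N * u β) := fun x => by
    have h := (legendre_gradient hP hne hu hψ hd x).2.2 β hβ
    rw [real_inner_comm] at h
    gcongr
    linarith
  have hnonneg := hessDet_nonneg hψC hmono
  have hmeas : Continuous fun x => Real.exp (N * (⟪β, x⟫ - ψ x)) * hessDet ψ x := by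
    have h₁ := continuous_hessDet hψC
    have h₂ := hψC.continuous
    fun_prop
  have hI : Integrable fun x => Real.exp (N * (⟪β, x⟫ - ψ x)) * hessDet ψ x := by
    refine (hint.const_mul (Real.exp (N * u β))).mono' hmeas.aestronglyMeasurable
      (Eventually.of_forall fun x => ?_)
    rw [Real.norm_of_nonneg (mul_nonneg (Real.exp_pos _).le (hnonneg x))]
    exact mul_le_mul_of_nonneg_right (hle x) (hnonneg x)
  refine ⟨hI, ?_⟩
  rw [← heq, ← integral_const_mul]
  exact integral_mono hI (hint.const_mul _) fun x =>
    mul_le_mul_of_nonneg_right (hle x) (hnonneg x)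

/-- Uniform Laplace-type lower bound: the exponential rate `u β` is reached up to `ε`, on a set of
`x` whose gradient image is a ball of fixed radius near `β`. -/
theorem exists_le_integral_exp_mul_hessDet (hP : IsCompact P) (hconv : Convex ℝ P)
    (hint : (interior P).Nonempty) (hu : ContinuousOn u P)
    (hψ : ∀ x, ψ x = sSup ((fun y => ⟪x, y⟫ - u y) '' P)) (hψC : ContDiff ℝ 2 ψ)
    (hbij : BijOn (gradient ψ) univ (interior P)) {ε : ℝ} (hε : 0 < ε) :
    ∃ c > 0, ∀ N : ℝ, 0 ≤ N → ∀ β ∈ P,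
      c * Real.exp (N * (u β - ε)) ≤ ∫ x, Real.exp (N * (⟪β, x⟫ - ψ x)) * hessDet ψ x := by
  have hne : P.Nonempty := hint.mono interior_subset
  have hd : Differentiable ℝ ψ := hψC.differentiable (by norm_num)
  have hmono := legendre_gradient_monotone hP hne hu hψ hd
  obtain ⟨b₀, hb₀⟩ := hint
  obtain ⟨r, hr, hball⟩ := Metric.isOpen_iff.1 isOpen_interior b₀ hb₀
  obtain ⟨D, hD⟩ := Metric.isBounded_iff.1 hP.isBounded
  have hD0 : 0 ≤ D := by simpa using hD (interior_subset hb₀) (interior_subset hb₀)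
  obtain ⟨δ, hδ, hδu⟩ := Metric.uniformContinuousOn_iff.1
    (hP.uniformContinuousOn_of_continuous hu) (ε / 2) (by positivity)
  obtain ⟨t, ht0, ht2, htδ⟩ : ∃ t : ℝ, 0 < t ∧ 2 * t ≤ 1 ∧ t * D < δ := by
    refine ⟨min (1 / 2) (δ / (2 * (D + 1))), by positivity, ?_, ?_⟩
    · linarith [min_le_left (1 / 2 : ℝ) (δ / (2 * (D + 1)))]
    · calc min (1 / 2) (δ / (2 * (D + 1))) * D ≤ δ / (2 * (D + 1)) * (D + 1) := by
            gcongr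
            · exact min_le_right _ _
            · linarith
        _ = δ / 2 := by field_simp
        _ < δ := by linarith
  refine ⟨volume.real (Metric.ball (0 : EuclideanSpace ℝ (Fin n)) (t * r)), ?_, ?_⟩
  · exact ENNReal.toReal_pos (Metric.measure_ball_pos _ _ (by positivity)).ne'
      measure_ball_lt_top.ne
  intro N hN β hβ
  set A := Metric.ball (β + t • (b₀ - β)) (t * r) with hA
  have hAeq : ∀ y ∈ A, ∃ b ∈ P, y = β + t • (b - β) := by
    intro y hy
    refine ⟨β + t⁻¹ • (y - β), interior_subset (hball ?_), ?_⟩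
    · rw [hA, mem_ball_iff_norm] at hy
      rw [mem_ball_iff_norm]
      have : β + t⁻¹ • (y - β) - b₀ = t⁻¹ • (y - (β + t • (b₀ - β))) := by
        simp only [smul_sub, smul_add, inv_smul_smul₀ ht0.ne']
        abel
      rw [this, norm_smul, Real.norm_of_nonneg (by positivity), inv_mul_lt_iff₀ ht0]
      exact hy
    · rw [add_sub_cancel_left, smul_inv_smul₀ ht0.ne', add_sub_cancel]
  have hAP : A ⊆ interior P := by
    refine interior_maximal (fun y hy => ?_) Metric.isOpen_ball
    obtain ⟨b, hb, rfl⟩ := hAeq y hy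
    exact hconv.add_smul_sub_mem hβ hb ⟨ht0.le, by linarith⟩
  obtain ⟨hSint, hSeq⟩ := integrableOn_hessDet_preimage_gradient hψC hmono hbij
    Metric.isOpen_ball.measurableSet hAP measure_ball_lt_top.ne
  have hbound : ∀ x ∈ gradient ψ ⁻¹' A, u β - ε ≤ ⟪β, x⟫ - ψ x := by
    intro x hx
    obtain ⟨hyP, hy, hmax⟩ := legendre_gradient hP hne hu hψ hd x
    obtain ⟨b, hb, hyb⟩ := hAeq _ hx
    set y := gradient ψ x
    have hz : β + (2 * t) • (b - β) ∈ P :=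
      hconv.add_smul_sub_mem hβ hb ⟨by positivity, ht2⟩
    have hzy : β + (2 * t) • (b - β) = y + y - β := by
      rw [hyb, two_mul, add_smul]
      abel
    rw [hzy] at hz
    have hdist : dist y β < δ := by
      rw [dist_eq_norm, hyb, add_sub_cancel_left, norm_smul, Real.norm_of_nonneg ht0.le,
        ← dist_eq_norm]
      exact (mul_le_mul_of_nonneg_left (hD hb hβ) ht0.le).trans_lt htδ
    have hdist' : dist y (y + y - β) < δ := by
      rwa [dist_comm, dist_eq_norm, show y + y - β - y = y - β by abel, ← dist_eq_norm]
    have h₁ := hδu y hyP β hβ hdist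
    have h₂ := hδu y hyP _ hz hdist'
    rw [Real.dist_eq, abs_lt] at h₁ h₂
    have h₃ := hmax _ hz
    rw [hy, inner_sub_right, inner_add_right] at h₃
    rw [hy, real_inner_comm]
    linarith [h₁.1, h₂.1]
  obtain ⟨hI, -⟩ := integrable_exp_mul_hessDet hP hne hu hψ hψC hbij hN hβ
  have hS : MeasurableSet (gradient ψ ⁻¹' A) :=
    (contDiff_gradient hψC).continuous.measurable Metric.isOpen_ball.measurableSet
  have hnonneg := hessDet_nonneg hψC hmono
  calc volume.real (Metric.ball (0 : EuclideanSpace ℝ (Fin n)) (t * r)) * Real.exp (N * (u β - ε))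
      = ∫ x in gradient ψ ⁻¹' A, Real.exp (N * (u β - ε)) * hessDet ψ x := by
        rw [integral_const_mul, hSeq, mul_comm, Measure.addHaar_real_ball_center volume (β + _)]
    _ ≤ ∫ x in gradient ψ ⁻¹' A, Real.exp (N * (⟪β, x⟫ - ψ x)) * hessDet ψ x := by
        refine setIntegral_mono_on (hSint.const_mul _) hI.integrableOn hS fun x hx => ?_
        have := hbound x hx
        have := hnonneg x
        gcongr
    _ ≤ ∫ x, Real.exp (N * (⟪β, x⟫ - ψ x)) * hessDet ψ x :=
        setIntegral_le_integral hI (Eventually.of_forall fun x =>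
          mul_nonneg (Real.exp_pos _).le (hnonneg x))

end LaplaceBounds

section LatticePoints

/-- Rounding convex weights to multiples of `1 / N` without decreasing a linear functional. -/
theorem exists_nat_weights {E : Type*} [NormedAddCommGroup E] [InnerProductSpace ℝ E]
    {s : Finset E} {t : E → ℝ} (ht0 : ∀ p ∈ s, 0 ≤ t p) (ht1 : ∑ p ∈ s, t p = 1) {D : ℝ}
    (hD : ∀ p ∈ s, ∀ q ∈ s, ‖p - q‖ ≤ D) (N : ℕ) (x : E) :
    ∃ m : E → ℕ, ∑ p ∈ s, m p = N ∧
      ‖∑ p ∈ s, (m p : ℝ) • p - (N : ℝ) • ∑ p ∈ s, t p • p‖ ≤ s.card * D ∧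
      (N : ℝ) * ⟪∑ p ∈ s, t p • p, x⟫ ≤ ⟪∑ p ∈ s, (m p : ℝ) • p, x⟫ := by
  classical
  have hs : s.Nonempty := by
    by_contra h
    rw [Finset.not_nonempty_iff_eq_empty] at h
    simp [h] at ht1
  obtain ⟨q, hq, hmax⟩ := s.exists_max_image (fun p => ⟪p, x⟫) hs
  let r : E → ℝ := fun p => N * t p - ⌊N * t p⌋₊
  have hr0 : ∀ p ∈ s, 0 ≤ r p := fun p hp =>
    sub_nonneg.2 (Nat.floor_le (mul_nonneg N.cast_nonneg (ht0 p hp)))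
  have hr1 : ∀ p, r p ≤ 1 := fun p => by
    have := Nat.lt_floor_add_one ((N : ℝ) * t p)
    simp only [r]
    linarith
  have hsumr : ∑ p ∈ s, r p = N - ∑ p ∈ s, (⌊N * t p⌋₊ : ℝ) := by
    rw [Finset.sum_sub_distrib, ← Finset.mul_sum, ht1, mul_one]
  have hfloor : ∑ p ∈ s, ⌊N * t p⌋₊ ≤ N := by
    have h := Finset.sum_nonneg hr0
    rw [hsumr] at h
    exact_mod_cast sub_nonneg.1 h
  let m : E → ℕ := fun p => ⌊N * t p⌋₊ + if p = q then N - ∑ p ∈ s, ⌊N * t p⌋₊ else 0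
  have hdiff : ∑ p ∈ s, (m p : ℝ) • p - (N : ℝ) • ∑ p ∈ s, t p • p
      = ∑ p ∈ s, r p • (q - p) := by
    have h₁ : ∑ p ∈ s, (m p : ℝ) • p = ∑ p ∈ s, (⌊N * t p⌋₊ : ℝ) • p + (∑ p ∈ s, r p) • q := by
      rw [hsumr]
      simp only [m, Nat.cast_add, add_smul, Finset.sum_add_distrib]
      congr 1
      rw [Finset.sum_eq_single q (fun p _ hp => by simp [hp]) (fun h => absurd hq h)]
      simp [Nat.cast_sub hfloor]
    rw [h₁]
    simp only [smul_sub, Finset.sum_sub_distrib, ← Finset.sum_smul, Finset.smul_sum, smul_smul]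
    have h₂ : ∑ p ∈ s, r p • p = ∑ p ∈ s, ((N : ℝ) * t p) • p - ∑ p ∈ s, (⌊N * t p⌋₊ : ℝ) • p := by
      simp only [r, sub_smul, Finset.sum_sub_distrib]
    rw [h₂]
    abel
  refine ⟨m, ?_, ?_, ?_⟩
  · simp only [m, Finset.sum_add_distrib, Finset.sum_ite_eq', hq, if_true]
    omega
  · rw [hdiff]
    refine (norm_sum_le _ _).trans ?_
    rw [← nsmul_eq_mul]
    refine Finset.sum_le_card_nsmul _ _ _ fun p hp => ?_
    rw [norm_smul, Real.norm_of_nonneg (hr0 p hp)]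
    exact (mul_le_of_le_one_left (norm_nonneg _) (hr1 p)).trans (hD q hq p hp)
  · rw [← sub_nonneg, ← real_inner_smul_left, ← inner_sub_left, hdiff, sum_inner]
    refine Finset.sum_nonneg fun p hp => ?_
    rw [real_inner_smul_left, inner_sub_left]
    exact mul_nonneg (hr0 p hp) (sub_nonneg.2 (hmax p hp))

variable {n d : ℕ}

theorem intPt_apply (α : Fin n → ℤ) (i : Fin n) : intPt α i = α i := rfl

theorem latPt_apply (α : Fin n → ℤ) (N : ℕ) (i : Fin n) : latPt α N i = α i / N := rfl

theorem smul_latPt (α : Fin n → ℤ) {N : ℕ} (hN : N ≠ 0) : (N : ℝ) • latPt α N = intPt α := by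
  ext i
  simp only [PiLp.smul_apply, latPt_apply, intPt_apply, smul_eq_mul]
  field_simp

theorem latPt_one (α : Fin n → ℤ) : latPt α 1 = intPt α := by
  simpa using smul_latPt α one_ne_zero

/-- A bounded set contains polynomially many points of `(1 / N) ℤⁿ`. -/
theorem exists_card_latPt_le {P : Set (EuclideanSpace ℝ (Fin n))} (hP : Bornology.IsBounded P) :
    ∃ R : ℕ, ∀ N : ℕ, N ≠ 0 → {α : Fin n → ℤ | latPt α N ∈ P}.Finite ∧
      {α : Fin n → ℤ | latPt α N ∈ P}.ncard ≤ (2 * (R * N) + 1) ^ n := by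
  obtain ⟨r, hr⟩ := isBounded_iff_forall_norm_le.1 hP
  obtain ⟨R, hR⟩ := exists_nat_ge r
  refine ⟨R, fun N hN => ?_⟩
  let B : Finset (Fin n → ℤ) := Fintype.piFinset fun _ => Finset.Icc (-(R * N : ℤ)) (R * N)
  have hsub : {α : Fin n → ℤ | latPt α N ∈ P} ⊆ B := by
    intro α hα
    have hNpos : (0 : ℝ) < N := by positivity
    simp only [B, Fintype.coe_piFinset, Set.mem_pi, Finset.coe_Icc, mem_univ, true_imp_iff]
    intro i
    have h := ((PiLp.norm_apply_le (latPt α N) i).trans (hr _ hα)).trans hR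
    rw [latPt_apply, Real.norm_eq_abs, abs_div, Nat.abs_cast, div_le_iff₀ hNpos, abs_le] at h
    exact ⟨by exact_mod_cast h.1, by exact_mod_cast h.2⟩
  refine ⟨B.finite_toSet.subset hsub, (ncard_le_ncard hsub B.finite_toSet).trans ?_⟩
  rw [ncard_coe_finset, Fintype.card_piFinset_const, Int.card_Icc]
  gcongr
  omega

variable {v : Fin d → Fin n → ℤ} {lam : Fin d → ℤ}

theorem continuous_ellZ (k : Fin d) : Continuous (ellZ v lam k) := by
  unfold ellZ
  fun_prop

theorem continuous_uGZ : Continuous (uGZ v lam) := by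
  unfold uGZ
  exact continuous_finsetSum _ fun k _ => Real.continuous_mul_log.comp (continuous_ellZ k)

theorem convex_polyZ : Convex ℝ (polyZ v lam) := by
  intro y hy z hz a b ha hb hab k
  have h : ellZ v lam k (a • y + b • z) = a * ellZ v lam k y + b * ellZ v lam k z := by
    simp only [ellZ, inner_add_left, real_inner_smul_left]
    linear_combination (lam k : ℝ) * hab
  rw [h]
  exact add_nonneg (mul_nonneg ha (hy k)) (mul_nonneg hb (hz k))

/-- The vertices of a Delzant lattice polytope are lattice points. -/
theorem exists_intPt_eq_of_mem_extremePoints (h : DelzantVertices v lam)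
    {y : EuclideanSpace ℝ (Fin n)} (hy : y ∈ extremePoints ℝ (polyZ v lam)) :
    ∃ α, intPt α = y := by
  have hspan : ∀ a ∈ Submodule.span ℤ (v '' {k | ellZ v lam k y = 0}),
      ∃ z : ℤ, ⟪y, intPt a⟫ = z := by
    intro a ha
    induction ha using Submodule.span_induction with
    | mem a ha =>
      obtain ⟨k, hk, rfl⟩ := ha
      exact ⟨lam k, sub_eq_zero.1 hk⟩
    | zero => exact ⟨0, by simp [PiLp.inner_apply, intPt_apply]⟩
    | add a b _ _ iha ihb =>
      obtain ⟨z, hz⟩ := iha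
      obtain ⟨w, hw⟩ := ihb
      refine ⟨z + w, ?_⟩
      have hadd : intPt (a + b) = intPt a + intPt b := by
        ext i
        simp [intPt_apply]
      rw [hadd, inner_add_right, hz, hw, Int.cast_add]
    | smul c a _ iha =>
      obtain ⟨z, hz⟩ := iha
      refine ⟨c * z, ?_⟩
      have hsmul : intPt (c • a) = (c : ℝ) • intPt a := by
        ext i
        simp [intPt_apply]
      rw [hsmul, real_inner_smul_right, hz, Int.cast_mul]
  rw [(h y hy).2] at hspan
  choose α hα using fun i : Fin n => hspan (Pi.single i 1) Submodule.mem_top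
  refine ⟨α, ?_⟩
  ext i
  rw [intPt_apply, ← hα i]
  simp [PiLp.inner_apply, intPt_apply, Pi.single_apply]

/-- Every point of a lattice polytope can be moved, by `O(1 / N)` and without decreasing a given
linear functional, to a point of `(1 / N) ℤⁿ` in the polytope. -/
theorem exists_latPt_approx (hPc : IsCompact (polyZ v lam)) (h : DelzantVertices v lam) :
    ∃ C : ℝ, ∀ N : ℕ, N ≠ 0 → ∀ y ∈ polyZ v lam, ∀ x : EuclideanSpace ℝ (Fin n),
      ∃ α, latPt α N ∈ polyZ v lam ∧ dist (latPt α N) y ≤ C / N ∧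
        ⟪y, x⟫ ≤ ⟪latPt α N, x⟫ := by
  obtain ⟨R, hR⟩ := exists_card_latPt_le hPc.isBounded
  have hfin : (extremePoints ℝ (polyZ v lam)).Finite := by
    refine ((hR 1 one_ne_zero).1.image intPt).subset fun y hy => ?_
    obtain ⟨α, rfl⟩ := exists_intPt_eq_of_mem_extremePoints h hy
    exact ⟨α, by simpa only [mem_ofPred_eq, latPt_one] using hy.1, rfl⟩
  have hhull : convexHull ℝ (extremePoints ℝ (polyZ v lam)) = polyZ v lam := by
    rw [← (hfin.isClosed_convexHull ℝ).closure_eq]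
    exact closure_convexHull_extremePoints hPc convex_polyZ
  obtain ⟨s, hs⟩ := hfin.exists_finset_coe
  have hsP : ∀ p ∈ s, p ∈ extremePoints ℝ (polyZ v lam) := fun p hp => hs ▸ hp
  obtain ⟨D, hD⟩ := Metric.isBounded_iff.1 hPc.isBounded
  choose! w hw using fun p hp => exists_intPt_eq_of_mem_extremePoints h (hsP p hp)
  refine ⟨s.card * D, fun N hN y hy x => ?_⟩
  have hNpos : (0 : ℝ) < N := by positivity
  rw [← hhull, ← hs, Finset.mem_convexHull'] at hy
  obtain ⟨t, ht0, ht1, rfl⟩ := hy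
  obtain ⟨m, hm, hnorm, hinner⟩ := exists_nat_weights ht0 ht1
    (fun p hp q hq => (dist_eq_norm p q).symm.trans_le (hD (hsP p hp).1 (hsP q hq).1)) N x
  have hα : intPt (∑ p ∈ s, (m p : ℤ) • w p) = ∑ p ∈ s, (m p : ℝ) • p := by
    ext i
    simp only [intPt_apply, Finset.sum_apply, Pi.smul_apply, smul_eq_mul, Int.cast_sum,
      Int.cast_mul, Int.cast_natCast, WithLp.ofLp_sum, WithLp.ofLp_smul]
    refine Finset.sum_congr rfl fun p hp => ?_
    rw [← intPt_apply (w p), hw p hp]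
  set α := ∑ p ∈ s, (m p : ℤ) • w p
  have hlat : latPt α N = (N : ℝ)⁻¹ • ∑ p ∈ s, (m p : ℝ) • p := by
    rw [← hα, ← smul_latPt α hN, inv_smul_smul₀ hNpos.ne']
  refine ⟨α, ?_, ?_, ?_⟩
  · rw [hlat, Finset.smul_sum]
    simp only [smul_smul]
    refine convex_polyZ.sum_mem (fun p _ => by positivity) ?_ fun p hp => (hsP p hp).1
    rw [← Finset.mul_sum, ← Nat.cast_sum, hm, inv_mul_cancel₀ hNpos.ne']
  · rw [dist_eq_norm, le_div_iff₀ hNpos, mul_comm, ← Real.norm_of_nonneg hNpos.le, ← norm_smul,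
      smul_sub, smul_latPt α hN, hα]
    exact hnorm
  · rw [hlat, real_inner_smul_left, ← div_eq_inv_mul, le_div_iff₀ hNpos, mul_comm]
    exact hinner

end LatticePoints

theorem eventually_mul_pow_le_exp (K : ℝ) (k : ℕ) {b : ℝ} (hb : 0 < b) :
    ∀ᶠ N : ℕ in atTop, K * (N : ℝ) ^ k ≤ Real.exp (N * b) := by
  have h := ((isLittleO_pow_exp_pos_mul_atTop k hb).comp_tendsto
    (tendsto_natCast_atTop_atTop (R := ℝ))).const_mul_left K
  filter_upwards [h.bound one_pos] with N hN
  simp only [Function.comp_apply, Real.norm_eq_abs, Real.abs_exp, one_mul] at hN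
  rw [mul_comm (N : ℝ)]
  exact (le_abs_self _).trans hN

/-- In the Delzant toric setup, the deviation E_N of the
symplectic-potential quantization from the Legendre transform potential ψ_s tends to 0
uniformly on `[0,T] × ℝⁿ` for every `T > 0`. -/
theorem deviation_tends_to_zero_uniformly
    (n d : ℕ) (v : Fin d → Fin n → ℤ) (lam : Fin d → ℤ)
    (hprim : ∀ k, Finset.univ.gcd (v k) = 1)
    (hPc : IsCompact (polyZ v lam)) (hPint : (interior (polyZ v lam)).Nonempty)
    (hfacet : ∀ k, IsFacetZ v lam k) (hdelzant : DelzantVertices v lam)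
    (F₀ : EuclideanSpace ℝ (Fin n) → ℝ) (V : Set (EuclideanSpace ℝ (Fin n)))
    (hV : IsOpen V) (hPV : polyZ v lam ⊆ V) (hF₀ : ContDiffOn ℝ (⊤ : ℕ∞) F₀ V)
    (u₀ : EuclideanSpace ℝ (Fin n) → ℝ) (hu₀ : ∀ y, u₀ y = uGZ v lam y + F₀ y)
    (hu₀conv : StrictConvexOn ℝ (interior (polyZ v lam)) u₀)
    (ψ₀ : EuclideanSpace ℝ (Fin n) → ℝ)
    (hψ₀ : ∀ x, ψ₀ x = sSup ((fun y => ⟪x, y⟫ - u₀ y) '' polyZ v lam))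
    (hψ₀smooth : ContDiff ℝ (⊤ : ℕ∞) ψ₀) (hψ₀conv : StrictConvexOn ℝ univ ψ₀)
    (hbij : Set.BijOn (gradient ψ₀) univ (interior (polyZ v lam)))
    (hinv : ∀ y ∈ interior (polyZ v lam), gradient ψ₀ (gradient u₀ y) = y)
    (udot : EuclideanSpace ℝ (Fin n) → ℝ) (W : Set (EuclideanSpace ℝ (Fin n)))
    (hW : IsOpen W) (hPW : polyZ v lam ⊆ W) (hudot : ContDiffOn ℝ (⊤ : ℕ∞) udot W)
    (Q : ℕ → (Fin n → ℤ) → ℝ)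
    (hQ : ∀ N α, Q N α = ∫ x, Real.exp (⟪intPt α, x⟫ - N * ψ₀ x) * hessDet ψ₀ x)
    (ψs : ℝ → EuclideanSpace ℝ (Fin n) → ℝ)
    (hψs : ∀ s x, ψs s x = sSup ((fun y => ⟪x, y⟫ - u₀ y - s * udot y) '' polyZ v lam))
    (EN : ℕ → ℝ → EuclideanSpace ℝ (Fin n) → ℝ)
    (hEN : ∀ N s x, EN N s x = (1 / (N : ℝ)) * Real.log
      (∑' α : {α : Fin n → ℤ // latPt α N ∈ polyZ v lam},
        Real.exp (-(s * N * udot (latPt α.1 N))) *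
          Real.exp (⟪intPt α.1, x⟫ - N * ψs s x) / Q N α.1)) :
    ∀ T > (0 : ℝ), ∀ ε > (0 : ℝ), ∃ N₀ : ℕ, ∀ N : ℕ, N₀ ≤ N →
      ∀ s ∈ Icc (0 : ℝ) T, ∀ x : EuclideanSpace ℝ (Fin n), |EN N s x| ≤ ε := by
  intro T hT ε hε
  have hne : (polyZ v lam).Nonempty := hPint.mono interior_subset
  have hu : ContinuousOn u₀ (polyZ v lam) :=
    (continuous_uGZ.continuousOn.add (hF₀.continuousOn.mono hPV)).congr fun y _ => hu₀ y
  have hud : ContinuousOn udot (polyZ v lam) := hudot.continuousOn.mono hPW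
  have hψC : ContDiff ℝ 2 ψ₀ := contDiff_infty.1 hψ₀smooth 2
  have hQ' : ∀ N : ℕ, N ≠ 0 → ∀ α,
      Q N α = ∫ x, Real.exp (N * (⟪latPt α N, x⟫ - ψ₀ x)) * hessDet ψ₀ x := by
    intro N hN α
    rw [hQ]
    simp only [← smul_latPt α hN, real_inner_smul_left, mul_sub]
  obtain ⟨c, hc, hQlow⟩ := exists_le_integral_exp_mul_hessDet hPc convex_polyZ hPint hu hψ₀ hψC
    hbij (half_pos hε)
  obtain ⟨R, hR⟩ := exists_card_latPt_le hPc.isBounded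
  obtain ⟨C, hC⟩ := exists_latPt_approx hPc hdelzant
  obtain ⟨δ₁, hδ₁, hδu⟩ := Metric.uniformContinuousOn_iff.1
    (hPc.uniformContinuousOn_of_continuous hu) (ε / 4) (by positivity)
  obtain ⟨δ₂, hδ₂, hδud⟩ := Metric.uniformContinuousOn_iff.1
    (hPc.uniformContinuousOn_of_continuous hud) (ε / (4 * T)) (by positivity)
  have hCN : ∀ᶠ N : ℕ in atTop, C / N < min δ₁ δ₂ :=
    (tendsto_const_div_atTop_nhds_zero_nat C).eventually_lt_const (lt_min hδ₁ hδ₂)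
  obtain ⟨N₀, hN₀⟩ := eventually_atTop.1 (((eventually_ne_atTop 0).and hCN).and
    ((eventually_mul_pow_le_exp (volume.real (interior (polyZ v lam))) 0 (half_pos hε)).and
      (eventually_mul_pow_le_exp ((2 * R + 1) ^ n / c) n (half_pos hε))))
  refine ⟨N₀, fun N hNN s hs x => ?_⟩
  obtain ⟨⟨hN, hCδ⟩, hNvol, hNpow⟩ := hN₀ N hNN
  have hNpos : (0 : ℝ) < N := by positivity
  rw [pow_zero, mul_one] at hNvol
  obtain ⟨hfin, hcard⟩ := hR N hN
  have : Fintype {α : Fin n → ℤ // latPt α N ∈ polyZ v lam} := hfin.fintype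
  obtain ⟨y, hyP, hy, hmax⟩ := exists_legendre_maximizer hPc hne
    (u := fun y => u₀ y + s * udot y) (by fun_prop) x
  have hψy : ψs s x = ⟪x, y⟫ - (u₀ y + s * udot y) := by
    rw [hψs, ← hy]
    simp only [sub_sub]
  have hterm : ∀ α, Real.exp (-(s * N * udot (latPt α N))) *
      Real.exp (⟪intPt α, x⟫ - N * ψs s x) / Q N α =
      Real.exp (N * (⟪x, latPt α N⟫ - (u₀ (latPt α N) + s * udot (latPt α N)) - ψs s x)) *
        (Real.exp (N * u₀ (latPt α N)) / Q N α) := by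
    intro α
    rw [← mul_div_assoc, ← Real.exp_add, ← Real.exp_add, ← smul_latPt α hN, real_inner_smul_left,
      real_inner_comm]
    congr 2
    ring
  have hQpos : ∀ α, latPt α N ∈ polyZ v lam → 0 < Q N α := fun α hα => by
    rw [hQ' N hN]
    exact (by positivity : 0 < c * _).trans_le (hQlow N hNpos.le _ hα)
  rw [hEN, tsum_fintype]
  simp only [hterm]
  obtain ⟨f, hf⟩ : ∃ f : {α : Fin n → ℤ // latPt α N ∈ polyZ v lam} → ℝ, ∀ α, f α =
      Real.exp (N * (⟪x, latPt α.1 N⟫ - (u₀ (latPt α.1 N) + s * udot (latPt α.1 N)) - ψs s x)) *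
        (Real.exp (N * u₀ (latPt α.1 N)) / Q N α.1) := ⟨_, fun _ => rfl⟩
  simp only [← hf]
  have hfpos : ∀ α, 0 ≤ f α := fun α => by
    have := hQpos α.1 α.2
    rw [hf]
    positivity
  have hupper : ∑ α, f α ≤ Real.exp (N * ε) := by
    have hle : ∀ α, f α ≤ Real.exp (N * (ε / 2)) / c := by
      rintro ⟨α, hα⟩
      have hm := hmax _ hα
      have hq := hQlow N hNpos.le _ hα
      rw [← hQ' N hN] at hq
      rw [hf, ← one_mul (Real.exp (N * (ε / 2)) / c)]
      have := hQpos α hα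
      refine mul_le_mul ?_ ?_ (by positivity) zero_le_one
      · rw [Real.exp_le_one_iff, hψy]
        exact mul_nonpos_of_nonneg_of_nonpos hNpos.le (sub_nonpos.2 hm)
      · rw [div_le_div_iff₀ this hc]
        refine le_trans (le_of_eq ?_) (mul_le_mul_of_nonneg_left hq (Real.exp_pos _).le)
        rw [mul_left_comm, ← Real.exp_add, mul_comm]
        congr 2
        ring
    have hcount : (Fintype.card {α : Fin n → ℤ // latPt α N ∈ polyZ v lam} : ℝ)
        ≤ (2 * R + 1) ^ n * (N : ℝ) ^ n := by
      rw [← Nat.card_eq_fintype_card]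
      refine (Nat.cast_le.2 hcard).trans ?_
      rw [← mul_pow]
      push_cast
      gcongr
      have : (1 : ℝ) ≤ N := by exact_mod_cast Nat.one_le_iff_ne_zero.2 hN
      linarith
    calc ∑ α, f α ≤ Fintype.card {α : Fin n → ℤ // latPt α N ∈ polyZ v lam} *
          (Real.exp (N * (ε / 2)) / c) := by
          rw [← nsmul_eq_mul]
          exact Finset.sum_le_card_nsmul _ _ _ fun α _ => hle α
      _ ≤ (2 * R + 1) ^ n * (N : ℝ) ^ n * (Real.exp (N * (ε / 2)) / c) := by gcongr
      _ = ((2 * R + 1) ^ n / c * (N : ℝ) ^ n) * Real.exp (N * (ε / 2)) := by ring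
      _ ≤ Real.exp (N * (ε / 2)) * Real.exp (N * (ε / 2)) := by gcongr
      _ = Real.exp (N * ε) := by
          rw [← Real.exp_add]
          congr 1
          ring
  have hlower : Real.exp (-(N * ε)) ≤ ∑ α, f α := by
    obtain ⟨α, hα, hdist, hinner⟩ := hC N hN y hyP x
    have hd := hdist.trans_lt hCδ
    have h₁ := hδu _ hα y hyP (hd.trans_le (min_le_left _ _))
    have h₂ := hδud _ hα y hyP (hd.trans_le (min_le_right _ _))
    rw [Real.dist_eq, abs_lt] at h₁ h₂
    have h₃ : s * (udot (latPt α N) - udot y) ≤ ε / 4 := by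
      calc s * (udot (latPt α N) - udot y) ≤ s * (ε / (4 * T)) :=
            mul_le_mul_of_nonneg_left h₂.2.le hs.1
        _ ≤ T * (ε / (4 * T)) := by
            gcongr
            exact hs.2
        _ = ε / 4 := by field_simp
    have hq := (integrable_exp_mul_hessDet hPc hne hu hψ₀ hψC hbij hNpos.le hα).2
    rw [← hQ' N hN] at hq
    have hQα := hQpos α hα
    calc Real.exp (-(N * ε))
        = Real.exp (N * -(ε / 2)) * (Real.exp (N * (ε / 2)))⁻¹ := by
          rw [← Real.exp_neg, ← Real.exp_add]
          congr 1
          ring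
      _ ≤ Real.exp (N * (⟪x, latPt α N⟫ - (u₀ (latPt α N) + s * udot (latPt α N)) - ψs s x)) *
          (Real.exp (N * u₀ (latPt α N)) / Q N α) := by
          gcongr
          · rw [real_inner_comm, real_inner_comm x] at hinner
            rw [hψy]
            linarith [h₁.2]
          · rw [inv_le_iff_one_le_mul₀ (Real.exp_pos _), div_mul_eq_mul_div, le_div_iff₀ hQα,
              one_mul]
            exact hq.trans (mul_le_mul_of_nonneg_left hNvol (Real.exp_pos _).le)
      _ ≤ ∑ α, f α := by
          rw [← hf ⟨α, hα⟩]
          exact Finset.single_le_sum (fun β _ => hfpos β) (Finset.mem_univ _)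
  have hsum_pos : 0 < ∑ α, f α := (Real.exp_pos _).trans_le hlower
  rw [one_div_mul_eq_div, abs_le]
  constructor
  · rw [le_div_iff₀ hNpos]
    have := (Real.le_log_iff_exp_le hsum_pos).2 hlower
    linarith
  · rw [div_le_iff₀ hNpos]
    have := (Real.log_le_iff_le_exp hsum_pos).2 hupper
    linarith
end
end
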